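/- arXiv:1811.01086 — 2 statements merged into one kernel-verified Lean document; each statement's English description precedes it below -/
import Mathlib

section
/- Assume additionally that ∂X_t = ∪_{i=1}^{n_X} {x ∈ X_t : g_i(x,t) = 0} for every t ∈ [0,T], that ∂TR = ∪_{j=1}^{n_TR} {x ∈ TR : l_j(x) = 0}, and that for every x ∈ ℝ^n the supremum defining u(x,0) is attained by some admissible uncertainty on [0,T]. Then the zero level set of u(·,0) is exactly the topological boundary of its zero sub-level set: {x ∈ ℝ^n : u(x,0) = 0} = ∂{x ∈ ℝ^n : u(x,0) ≤ 0}. -/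
open Set MeasureTheory RealInnerProductSpace Filter Topology

noncomputable section

abbrev EucSp (n : ℕ) : Type := EuclideanSpace ℝ (Fin n)

/-- An admissible uncertainty on `[t, T]`: a measurable map taking values in `D` there. -/
def Admissible {m : ℕ} (D : Set (EucSp m)) (t T : ℝ) (d : ℝ → EucSp m) : Prop :=
  Measurable d ∧ ∀ s ∈ Set.Icc t T, d s ∈ D

/-- `y` solves `ẏ(s) = F (y s) (d s)` on `[t, T]` with `y t = x` (integral form,
equivalent to absolute continuity together with the a.e. differential equation). -/
def IsTraj {n m : ℕ} (F : EucSp n → EucSp m → EucSp n) (d : ℝ → EucSp m)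
    (t T : ℝ) (x : EucSp n) (y : ℝ → EucSp n) : Prop :=
  y t = x ∧ ∀ s ∈ Set.Icc t T, y s = x + ∫ r in t..s, F (y r) (d r)

/-- The payoff of a trajectory `y` on `[t, T]`:
`max { max_j l_j (y T), max_i sup_{s ∈ [t,T]} g_i (y s, s) }`. -/
def payoff {n nX nTR : ℕ} (g : Fin nX → EucSp n → ℝ → ℝ) (l : Fin nTR → EucSp n → ℝ)
    (t T : ℝ) (y : ℝ → EucSp n) : ℝ :=
  max (⨆ j, l j (y T)) (⨆ i, sSup ((fun s => g i (y s) s) '' Set.Icc t T))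

/-- The defining property of the value function `u`: for `(x, t) ∈ ℝⁿ × [0, T]`,
`u (x, t)` is the supremum of the payoffs over all admissible uncertainties on `[t, T]`
(the trajectory being the unique solution of the ODE driven by the uncertainty). -/
def IsValueFun {n m nX nTR : ℕ} (F : EucSp n → EucSp m → EucSp n) (D : Set (EucSp m))
    (g : Fin nX → EucSp n → ℝ → ℝ) (l : Fin nTR → EucSp n → ℝ) (T : ℝ)
    (u : EucSp n → ℝ → ℝ) : Prop :=
  ∀ x : EucSp n, ∀ t ∈ Set.Icc (0:ℝ) T,
    u x t = sSup {r | ∃ d y, Admissible D t T d ∧ IsTraj F d t T x y ∧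
      r = payoff g l t T y}

/-- The Hamiltonian `H(x, p) = max_{d ∈ D} ⟪p, F x d⟫`. -/
def Ham {n m : ℕ} (F : EucSp n → EucSp m → EucSp n) (D : Set (EucSp m))
    (x p : EucSp n) : ℝ :=
  sSup ((fun d => ⟪p, F x d⟫) '' D)

/-- Viscosity super-solution of `max{∂ₜ w + H(x, ∇ₓ w), maxᵢ gᵢ(x,t) - w} = 0` on
`ℝⁿ × [0, T]`: a lower semicontinuous function such that for every smooth test function
`ψ` such that `w - ψ` attains a local minimum at `(x₀, t₀) ∈ ℝⁿ × [0, T]`, one has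
`max{∂ₜ ψ(x₀,t₀) + H(x₀, ∇ₓ ψ(x₀,t₀)), maxᵢ gᵢ(x₀,t₀) - w(x₀,t₀)} ≤ 0`. -/
def ViscSuper {n m nX : ℕ} (F : EucSp n → EucSp m → EucSp n) (D : Set (EucSp m))
    (g : Fin nX → EucSp n → ℝ → ℝ) (T : ℝ) (w : EucSp n → ℝ → ℝ) : Prop :=
  LowerSemicontinuousOn (fun p : EucSp n × ℝ => w p.1 p.2) (Set.univ ×ˢ Set.Icc 0 T) ∧
  ∀ ψ : EucSp n → ℝ → ℝ, ContDiff ℝ (⊤ : ℕ∞) (fun p : EucSp n × ℝ => ψ p.1 p.2) →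
    ∀ x₀ : EucSp n, ∀ t₀ ∈ Set.Icc (0:ℝ) T,
      IsLocalMinOn (fun p : EucSp n × ℝ => w p.1 p.2 - ψ p.1 p.2)
        (Set.univ ×ˢ Set.Icc 0 T) (x₀, t₀) →
      max (deriv (ψ x₀) t₀ + Ham F D x₀ (gradient (fun z => ψ z t₀) x₀))
        ((⨆ i, g i x₀ t₀) - w x₀ t₀) ≤ 0

/-- Viscosity sub-solution of `max{∂ₜ w + H(x, ∇ₓ w), maxᵢ gᵢ(x,t) - w} = 0` on
`ℝⁿ × [0, T]`. -/
def ViscSub {n m nX : ℕ} (F : EucSp n → EucSp m → EucSp n) (D : Set (EucSp m))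
    (g : Fin nX → EucSp n → ℝ → ℝ) (T : ℝ) (w : EucSp n → ℝ → ℝ) : Prop :=
  UpperSemicontinuousOn (fun p : EucSp n × ℝ => w p.1 p.2) (Set.univ ×ˢ Set.Icc 0 T) ∧
  ∀ ψ : EucSp n → ℝ → ℝ, ContDiff ℝ (⊤ : ℕ∞) (fun p : EucSp n × ℝ => ψ p.1 p.2) →
    ∀ x₀ : EucSp n, ∀ t₀ ∈ Set.Icc (0:ℝ) T,
      IsLocalMaxOn (fun p : EucSp n × ℝ => w p.1 p.2 - ψ p.1 p.2)
        (Set.univ ×ˢ Set.Icc 0 T) (x₀, t₀) →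
      0 ≤ max (deriv (ψ x₀) t₀ + Ham F D x₀ (gradient (fun z => ψ z t₀) x₀))
        ((⨆ i, g i x₀ t₀) - w x₀ t₀)

/-- The backward reachable set at time `t` (horizon `T`) of the target `{maxⱼ lⱼ ≤ 0}`
under state constraints `{maxᵢ gᵢ(·, s) ≤ 0}`, for the dynamics `f` driven by
uncertainties in `D`: the set of `x` such that for every admissible uncertainty the
(unique) solution extends to all of `[t, T]`, respects the state constraints there,
and ends up in the target at time `T`. -/
def Reach {n m nX nTR : ℕ} (f : EucSp n → EucSp m → EucSp n) (D : Set (EucSp m))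
    (g : Fin nX → EucSp n → ℝ → ℝ) (l : Fin nTR → EucSp n → ℝ)
    (t T : ℝ) : Set (EucSp n) :=
  {x | ∀ d, Admissible D t T d → ∃ y, IsTraj f d t T x y ∧
    (∀ s ∈ Set.Icc t T, ∀ i, g i (y s) s ≤ 0) ∧ ∀ j, l j (y T) ≤ 0}

section Caratheodory

variable {E : Type*} [NormedAddCommGroup E] {f : ℝ → E → E} {L M : ℝ}

/-- A Carathéodory vector field with Lipschitz constant `L`, bounded by `M` at the origin. -/
structure IsCaratheodoryField (f : ℝ → E → E) (L M : ℝ) : Prop where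
  nonneg : 0 ≤ L
  aestronglyMeasurable : ∀ y : ℝ → E, Continuous y →
    AEStronglyMeasurable (fun r => f r (y r)) volume
  lipschitz : ∀ r x y, ‖f r x - f r y‖ ≤ L * ‖x - y‖
  bounded : ∀ r, ‖f r 0‖ ≤ M

theorem IsCaratheodoryField.intervalIntegrable (hf : IsCaratheodoryField f L M)
    {y : ℝ → E} (hy : Continuous y) (a b : ℝ) :
    IntervalIntegrable (fun r => f r (y r)) volume a b := by
  have hdom : IntervalIntegrable (fun r => M + L * ‖y r‖) volume a b :=
    Continuous.intervalIntegrable (by fun_prop) _ _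
  refine hdom.mono_fun (hf.aestronglyMeasurable y hy).restrict (Eventually.of_forall fun r => ?_)
  have h1 := hf.lipschitz r (y r) 0
  have h2 := hf.bounded r
  have h3 := norm_sub_norm_le (f r (y r)) (f r 0)
  rw [sub_zero] at h1
  exact le_trans (by linarith) (le_abs_self _)

variable [NormedSpace ℝ E]

theorem abs_integral_exp_mul_abs_sub_le {K : ℝ} (hK : 0 < K) (τ s : ℝ) :
    |∫ r in τ..s, Real.exp (K * |r - τ|)| ≤ Real.exp (K * |s - τ|) / K := by
  rcases le_total τ s with h | h
  · have hder : ∀ r ∈ uIcc τ s,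
        HasDerivAt (fun r => Real.exp (K * (r - τ)) / K) (Real.exp (K * (r - τ))) r := by
      intro r _
      have := ((((hasDerivAt_id r).sub_const τ).const_mul K).exp).div_const K
      refine this.congr_deriv ?_
      simp only [id]
      field_simp
    have hcongr : ∫ r in τ..s, Real.exp (K * |r - τ|) = ∫ r in τ..s, Real.exp (K * (r - τ)) := by
      refine intervalIntegral.integral_congr fun r hr => ?_
      rw [uIcc_of_le h] at hr
      simp only [abs_of_nonneg (sub_nonneg.2 hr.1)]
    rw [hcongr, intervalIntegral.integral_eq_sub_of_hasDerivAt hder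
      (Continuous.intervalIntegrable (by fun_prop) _ _), abs_of_nonneg (sub_nonneg.2 h), abs_le]
    have h1 : Real.exp (K * (τ - τ)) / K ≤ Real.exp (K * (s - τ)) / K := by gcongr
    have h2 : 0 < Real.exp (K * (τ - τ)) / K := by positivity
    constructor <;> linarith
  · have hder : ∀ r ∈ uIcc τ s,
        HasDerivAt (fun r => -(Real.exp (K * (τ - r)) / K)) (Real.exp (K * (τ - r))) r := by
      intro r _
      have := (((((hasDerivAt_id r).const_sub τ).const_mul K).exp).div_const K).neg
      refine this.congr_deriv ?_
      simp only [id]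
      field_simp
    have hcongr : ∫ r in τ..s, Real.exp (K * |r - τ|) = ∫ r in τ..s, Real.exp (K * (τ - r)) := by
      refine intervalIntegral.integral_congr fun r hr => ?_
      rw [uIcc_of_ge h] at hr
      simp only [abs_of_nonpos (sub_nonpos.2 hr.2), neg_sub]
    rw [hcongr, intervalIntegral.integral_eq_sub_of_hasDerivAt hder
      (Continuous.intervalIntegrable (by fun_prop) _ _), abs_of_nonpos (sub_nonpos.2 h), neg_sub,
      abs_le]
    have h1 : Real.exp (K * (τ - τ)) / K ≤ Real.exp (K * (τ - s)) / K := by gcongr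
    have h2 : 0 < Real.exp (K * (τ - τ)) / K := by positivity
    constructor <;> linarith

theorem norm_integral_le_of_norm_le_exp {f : ℝ → E} {K A τ s : ℝ} (hK : 0 < K) (hA : 0 ≤ A)
    (hf : ∀ r ∈ uIcc τ s, ‖f r‖ ≤ A * Real.exp (K * |r - τ|)) :
    ‖∫ r in τ..s, f r‖ ≤ A / K * Real.exp (K * |s - τ|) := by
  calc ‖∫ r in τ..s, f r‖ ≤ |∫ r in τ..s, A * Real.exp (K * |r - τ|)| := by
        refine intervalIntegral.norm_integral_le_abs_of_norm_le ?_
          (Continuous.intervalIntegrable (by fun_prop) _ _)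
        exact (ae_restrict_iff' measurableSet_uIoc).2
          (Eventually.of_forall fun r hr => hf r (uIoc_subset_uIcc hr))
    _ = A * |∫ r in τ..s, Real.exp (K * |r - τ|)| := by
        rw [intervalIntegral.integral_const_mul, abs_mul, abs_of_nonneg hA]
    _ ≤ A * (Real.exp (K * |s - τ|) / K) := by
        gcongr
        exact abs_integral_exp_mul_abs_sub_le hK τ s
    _ = _ := by ring

/-- An integral form of Grönwall's inequality, valid on both sides of the base point `τ`. -/
theorem le_of_le_add_abs_integral {h : ℝ → ℝ} {a b τ δ L : ℝ} (hL : 0 ≤ L) (hδ : 0 ≤ δ)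
    (hτ : τ ∈ Icc a b) (hcont : ContinuousOn h (Icc a b)) (hpos : ∀ s ∈ Icc a b, 0 ≤ h s)
    (hint : ∀ s ∈ Icc a b, h s ≤ δ + L * |∫ r in τ..s, h r|) :
    ∀ s ∈ Icc a b, h s ≤ 2 * δ * Real.exp ((2 * L + 1) * |s - τ|) := by
  set K : ℝ := 2 * L + 1 with hKdef
  have hK : 0 < K := by positivity
  have hexp : Continuous fun s : ℝ => Real.exp (-(K * |s - τ|)) := by fun_prop
  obtain ⟨m, hm, hmax⟩ := isCompact_Icc.exists_isMaxOn ⟨τ, hτ⟩ (hcont.mul hexp.continuousOn)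
  set H := h m * Real.exp (-(K * |m - τ|)) with hH
  have hH0 : 0 ≤ H := mul_nonneg (hpos m hm) (Real.exp_pos _).le
  have hle : ∀ s ∈ Icc a b, h s ≤ H * Real.exp (K * |s - τ|) := fun s hs => by
    have : h s * Real.exp (-(K * |s - τ|)) ≤ H := hmax hs
    rw [Real.exp_neg] at this
    rwa [← div_eq_mul_inv, div_le_iff₀ (Real.exp_pos _)] at this
  have hmint : |∫ r in τ..m, h r| ≤ H / K * Real.exp (K * |m - τ|) := by
    rw [← Real.norm_eq_abs]
    refine norm_integral_le_of_norm_le_exp hK hH0 fun r hr => ?_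
    have hr' : r ∈ Icc a b := uIcc_subset_Icc hτ hm hr
    rw [Real.norm_of_nonneg (hpos r hr')]
    exact hle r hr'
  have hHle : H ≤ δ + L * (H / K) := by
    have h1 : h m ≤ δ + L * (H / K * Real.exp (K * |m - τ|)) :=
      (hint m hm).trans (by gcongr)
    have h2 : Real.exp (-(K * |m - τ|)) ≤ 1 := Real.exp_le_one_iff.2 (by
      have : 0 ≤ K * |m - τ| := by positivity
      linarith)
    have h3 : Real.exp (K * |m - τ|) * Real.exp (-(K * |m - τ|)) = 1 := by
      rw [← Real.exp_add]; simp
    calc H ≤ (δ + L * (H / K * Real.exp (K * |m - τ|))) * Real.exp (-(K * |m - τ|)) := by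
          rw [hH]; gcongr
      _ = δ * Real.exp (-(K * |m - τ|))
          + L * (H / K) * (Real.exp (K * |m - τ|) * Real.exp (-(K * |m - τ|))) := by ring
      _ ≤ δ * 1 + L * (H / K) * 1 := by rw [h3]; gcongr
      _ = _ := by ring
  have hhalf : L * (H / K) ≤ H / 2 := by
    rw [mul_div_assoc', div_le_div_iff₀ hK two_pos]
    nlinarith
  intro s hs
  refine (hle s hs).trans ?_
  gcongr
  linarith

/-- `Y` is a global solution, in integral form, of `Ẏ(r) = f r (Y r)`. -/
def IsGlobalSolution (f : ℝ → E → E) (Y : ℝ → E) : Prop :=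
  Continuous Y ∧ ∀ a b, Y b = Y a + ∫ r in a..b, f r (Y r)

/-- Global existence for Carathéodory differential equations with a globally Lipschitz
right-hand side. -/
theorem IsCaratheodoryField.exists_isGlobalSolution [CompleteSpace E]
    (hf : IsCaratheodoryField f L M) (τ : ℝ) (z : E) :
    ∃ Y : ℝ → E, IsGlobalSolution f Y ∧ Y τ = z := by
  have hL := hf.nonneg
  set K : ℝ := 2 * L + 1 with hKdef
  have hK : 0 < K := by positivity
  have hM : 0 ≤ M := (norm_nonneg _).trans (hf.bounded 0)
  let e : ℝ → ℝ := fun s => Real.exp (K * |s - τ|)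
  have he : Continuous e := by fun_prop
  have he0 : ∀ s, 0 < e s := fun s => Real.exp_pos _
  have he1 : ∀ s, 1 ≤ e s := fun s => Real.one_le_exp (by positivity)
  have hint : ∀ (w : BoundedContinuousFunction ℝ E) (a b : ℝ),
      IntervalIntegrable (fun r => f r (e r • w r)) volume a b := fun w a b =>
    hf.intervalIntegrable (he.smul w.continuous) a b
  have hbound : ∀ (w : BoundedContinuousFunction ℝ E) (s : ℝ),
      ‖(e s)⁻¹ • (z + ∫ r in τ..s, f r (e r • w r))‖ ≤ ‖z‖ + (M + L * ‖w‖) / K := by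
    intro w s
    have h1 : ‖∫ r in τ..s, f r (e r • w r)‖ ≤ (M + L * ‖w‖) / K * e s := by
      refine norm_integral_le_of_norm_le_exp hK (by positivity) fun r _ => ?_
      have h1 := hf.lipschitz r (e r • w r) 0
      have h2 := hf.bounded r
      have h3 := norm_sub_norm_le (f r (e r • w r)) (f r 0)
      rw [sub_zero, norm_smul, Real.norm_of_nonneg (he0 r).le] at h1
      have h4 : L * (e r * ‖w r‖) ≤ L * (e r * ‖w‖) := by
        have := he0 r
        gcongr
        exact w.norm_coe_le_norm r
      have h5 : M * 1 ≤ M * e r := by gcongr; exact he1 r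
      change _ ≤ (M + L * ‖w‖) * e r
      nlinarith
    rw [norm_smul, norm_inv, Real.norm_of_nonneg (he0 s).le, inv_mul_le_iff₀ (he0 s)]
    have h2 : 1 * ‖z‖ ≤ e s * ‖z‖ := by gcongr; exact he1 s
    calc _ ≤ ‖z‖ + (M + L * ‖w‖) / K * e s := (norm_add_le _ _).trans (by gcongr)
      _ ≤ _ := by linarith
  let Ψ : BoundedContinuousFunction ℝ E → BoundedContinuousFunction ℝ E := fun w =>
    BoundedContinuousFunction.ofNormedAddCommGroup
      (fun s => (e s)⁻¹ • (z + ∫ r in τ..s, f r (e r • w r)))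
      ((he.inv₀ fun s => (he0 s).ne').smul
        (continuous_const.add (intervalIntegral.continuous_primitive (hint w) τ)))
      _ (hbound w)
  have hΨ : ContractingWith (1 / 2) Ψ := by
    refine ⟨by norm_num, LipschitzWith.of_dist_le_mul fun v w => ?_⟩
    rw [BoundedContinuousFunction.dist_le (by positivity)]
    intro s
    change dist ((e s)⁻¹ • (z + ∫ r in τ..s, f r (e r • v r)))
      ((e s)⁻¹ • (z + ∫ r in τ..s, f r (e r • w r))) ≤ _
    rw [dist_eq_norm, ← smul_sub, add_sub_add_left_eq_sub,
      ← intervalIntegral.integral_sub (hint v τ s) (hint w τ s), norm_smul, norm_inv,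
      Real.norm_of_nonneg (he0 s).le, inv_mul_le_iff₀ (he0 s)]
    have h1 : ‖∫ r in τ..s, (f r (e r • v r) - f r (e r • w r))‖ ≤ (L * dist v w) / K * e s := by
      refine norm_integral_le_of_norm_le_exp hK (by positivity) fun r _ => ?_
      refine (hf.lipschitz r _ _).trans ?_
      rw [← smul_sub, norm_smul, Real.norm_of_nonneg (he0 r).le, ← dist_eq_norm]
      have := he0 r
      calc L * (e r * dist (v r) (w r)) ≤ L * (e r * dist v w) := by
            gcongr
            exact BoundedContinuousFunction.dist_coe_le_dist r
        _ = _ := by ring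
    refine h1.trans ?_
    have h2 : L * dist v w / K ≤ dist v w / 2 := by
      rw [div_le_div_iff₀ hK two_pos]
      nlinarith [dist_nonneg (x := v) (y := w)]
    have h3 := mul_le_mul_of_nonneg_right h2 (he0 s).le
    refine h3.trans (le_of_eq ?_)
    push_cast
    ring
  have hfix := hΨ.fixedPoint_isFixedPt
  set w := ContractingWith.fixedPoint Ψ hΨ
  have hY : ∀ s, e s • w s = z + ∫ r in τ..s, f r (e r • w r) := fun s => by
    have h1 : w s = (e s)⁻¹ • (z + ∫ r in τ..s, f r (e r • w r)) := by
      conv_lhs => rw [← hfix]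
      rfl
    conv_lhs => rw [h1, smul_inv_smul₀ (he0 s).ne']
  refine ⟨fun s => e s • w s, ⟨he.smul w.continuous, fun a b => ?_⟩, ?_⟩
  · change e b • w b = e a • w a + ∫ r in a..b, f r (e r • w r)
    rw [hY a, hY b, add_assoc, intervalIntegral.integral_add_adjacent_intervals
      (hint w τ a) (hint w a b)]
  · simpa using hY τ

theorem norm_integral_le_mul_abs_integral {F : ℝ → E} {h : ℝ → ℝ} {τ s : ℝ} (hL : 0 ≤ L)
    (hF : ∀ r ∈ uIcc τ s, ‖F r‖ ≤ L * h r) (hh : IntervalIntegrable h volume τ s) :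
    ‖∫ r in τ..s, F r‖ ≤ L * |∫ r in τ..s, h r| := by
  have h1 : ‖∫ r in τ..s, F r‖ ≤ |∫ r in τ..s, L * h r| :=
    intervalIntegral.norm_integral_le_abs_of_norm_le
      ((ae_restrict_iff' measurableSet_uIoc).2
        (Eventually.of_forall fun r hr => hF r (uIoc_subset_uIcc hr))) (hh.const_mul L)
  rwa [intervalIntegral.integral_const_mul, abs_mul, abs_of_nonneg hL] at h1

/-- Two global solutions stay close to each other on bounded intervals. -/
theorem IsCaratheodoryField.norm_sub_le (hf : IsCaratheodoryField f L M) {Y Z : ℝ → E}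
    (hY : IsGlobalSolution f Y) (hZ : IsGlobalSolution f Z) {T τ s : ℝ}
    (hτ : τ ∈ Icc 0 T) (hs : s ∈ Icc 0 T) :
    ‖Y s - Z s‖ ≤ 2 * Real.exp ((2 * L + 1) * T) * ‖Y τ - Z τ‖ := by
  have hcont : Continuous fun r => ‖Y r - Z r‖ := (hY.1.sub hZ.1).norm
  have hL := hf.nonneg
  have h1 := le_of_le_add_abs_integral (h := fun r => ‖Y r - Z r‖) hL
    (norm_nonneg (Y τ - Z τ)) hτ hcont.continuousOn (fun _ _ => norm_nonneg _) (fun r _ => by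
      have h2 : Y r - Z r = (Y τ - Z τ) + ∫ q in τ..r, (f q (Y q) - f q (Z q)) := by
        rw [intervalIntegral.integral_sub (hf.intervalIntegrable hY.1 _ _)
          (hf.intervalIntegrable hZ.1 _ _), hY.2 τ r, hZ.2 τ r]
        abel
      rw [h2]
      refine (norm_add_le _ _).trans ?_
      gcongr
      exact norm_integral_le_mul_abs_integral hL (fun q _ => hf.lipschitz q _ _)
        (hcont.intervalIntegrable _ _)) s hs
  have h3 : |s - τ| ≤ T := abs_le.2 ⟨by linarith [hs.1, hτ.2], by linarith [hs.2, hτ.1]⟩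
  calc ‖Y s - Z s‖ ≤ 2 * ‖Y τ - Z τ‖ * Real.exp ((2 * L + 1) * |s - τ|) := h1
    _ ≤ 2 * ‖Y τ - Z τ‖ * Real.exp ((2 * L + 1) * T) := by gcongr
    _ = _ := by ring

/-- A priori bound for solutions in terms of the vector field at the initial point. -/
theorem IsCaratheodoryField.norm_sub_initial_le (hf : IsCaratheodoryField f L M) {Y : ℝ → E}
    (hY : IsGlobalSolution f Y) {T s B : ℝ} (hB : ∀ r ∈ Icc 0 T, ‖f r (Y 0)‖ ≤ B)
    (hs : s ∈ Icc 0 T) :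
    ‖Y s - Y 0‖ ≤ 2 * (B * T) * Real.exp ((2 * L + 1) * T) := by
  have hcont : Continuous fun r => ‖Y r - Y 0‖ := (hY.1.sub continuous_const).norm
  have hL := hf.nonneg
  have hT : 0 ≤ T := hs.1.trans hs.2
  have h0 : (0 : ℝ) ∈ Icc 0 T := ⟨le_rfl, hT⟩
  have hB0 : 0 ≤ B := (norm_nonneg _).trans (hB 0 h0)
  have h1 := le_of_le_add_abs_integral (h := fun r => ‖Y r - Y 0‖) (δ := B * T) hL
    (by positivity) h0 hcont.continuousOn (fun _ _ => norm_nonneg _) (fun r hr => by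
      have hconst := hf.intervalIntegrable (continuous_const (y := Y 0)) 0 r
      have h2 : Y r - Y 0 = (∫ q in 0..r, f q (Y 0)) + ∫ q in 0..r, (f q (Y q) - f q (Y 0)) := by
        rw [intervalIntegral.integral_sub (hf.intervalIntegrable hY.1 _ _) hconst, hY.2 0 r]
        abel
      rw [h2]
      refine (norm_add_le _ _).trans (add_le_add ?_ ?_)
      · have h3 := intervalIntegral.norm_integral_le_of_norm_le_const (a := 0) (b := r) (C := B)
          (f := fun q => f q (Y 0)) fun q hq => by
            rw [uIoc_of_le hr.1] at hq
            exact hB q ⟨hq.1.le, hq.2.trans hr.2⟩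
        rw [sub_zero, abs_of_nonneg hr.1] at h3
        exact h3.trans (by gcongr; exact hr.2)
      · exact norm_integral_le_mul_abs_integral hL (fun q _ => hf.lipschitz q _ _)
          (hcont.intervalIntegrable _ _)) s hs
  have h3 : |s - 0| ≤ T := by rw [sub_zero, abs_of_nonneg hs.1]; exact hs.2
  exact h1.trans (by gcongr)

end Caratheodory

section Trajectories

variable {n m : ℕ} {T : ℝ} {D : Set (EucSp m)} {F : EucSp n → EucSp m → EucSp n} {LF : ℝ}

theorem Admissible.exists_isCaratheodoryField (hDne : D.Nonempty) (hDcomp : IsCompact D)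
    (hFcont : Continuous fun p : EucSp n × EucSp m => F p.1 p.2) (hLF : 0 ≤ LF)
    (hFlip : ∀ x y : EucSp n, ∀ d ∈ D, ‖F x d - F y d‖ ≤ LF * ‖x - y‖)
    {d : ℝ → EucSp m} (hd : Admissible D 0 T d) :
    ∃ f M, IsCaratheodoryField f LF M ∧ ∀ r ∈ Icc 0 T, ∀ x, f r x = F x (d r) := by
  classical
  obtain ⟨d₀, hd₀⟩ := hDne
  let e : ℝ → EucSp m := (Icc 0 T).piecewise d fun _ => d₀
  have he : Measurable e := Measurable.piecewise measurableSet_Icc hd.1 measurable_const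
  have heD : ∀ r, e r ∈ D := fun r => by
    by_cases hr : r ∈ Icc 0 T
    · simpa [e, hr] using hd.2 r hr
    · simpa [e, hr] using hd₀
  obtain ⟨M, hM⟩ := hDcomp.exists_bound_of_continuousOn (f := fun d => F 0 d)
    (hFcont.comp (by fun_prop : Continuous fun d : EucSp m => ((0 : EucSp n), d))).continuousOn
  refine ⟨fun r x => F x (e r), M, ⟨hLF, fun y hy => ?_, fun r x y => hFlip x y _ (heD r),
    fun r => hM _ (heD r)⟩, fun r hr x => ?_⟩
  · exact (hFcont.measurable.comp (hy.measurable.prodMk he)).aestronglyMeasurable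
  · simp only [e, piecewise_eq_of_mem _ _ _ hr]

variable {f : ℝ → EucSp n → EucSp n} {M : ℝ} {d : ℝ → EucSp m}

/-- A trajectory whose velocity is integrable on `[0, s]` agrees there with the global solution. -/
theorem IsTraj.eq_of_intervalIntegrable (hf : IsCaratheodoryField f LF M)
    (hfd : ∀ r ∈ Icc 0 T, ∀ x, f r x = F x (d r)) {y Y : ℝ → EucSp n} {x : EucSp n}
    (hy : IsTraj F d 0 T x y) (hY : IsGlobalSolution f Y) (hY0 : Y 0 = x) {s : ℝ}
    (hs : s ∈ Icc 0 T) (hint : IntervalIntegrable (fun r => F (y r) (d r)) volume 0 s) :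
    ∀ r ∈ Icc 0 s, y r = Y r := by
  have hsub : ∀ r ∈ Icc 0 s, r ∈ Icc 0 T := fun r hr => ⟨hr.1, hr.2.trans hs.2⟩
  have hcont : ContinuousOn y (Icc 0 s) := by
    have h1 := intervalIntegral.continuousOn_primitive_interval' hint left_mem_uIcc
    rw [uIcc_of_le hs.1] at h1
    exact (continuousOn_const.add h1).congr fun r hr => hy.2 r (hsub r hr)
  have hcont' : ContinuousOn (fun r => ‖y r - Y r‖) (Icc 0 s) :=
    (hcont.sub hY.1.continuousOn).norm
  intro r hr
  have h1 := le_of_le_add_abs_integral (h := fun r => ‖y r - Y r‖) hf.nonneg le_rfl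
    (left_mem_Icc.2 hs.1) hcont' (fun _ _ => norm_nonneg _) (fun q hq => by
      have hsubq : uIcc 0 q ⊆ Icc 0 s := uIcc_subset_Icc (left_mem_Icc.2 hs.1) hq
      have hintq : IntervalIntegrable (fun r => F (y r) (d r)) volume 0 q :=
        hint.mono_set (by rw [uIcc_of_le hs.1]; exact hsubq)
      have h2 : y q - Y q = ∫ r in 0..q, (F (y r) (d r) - f r (Y r)) := by
        rw [intervalIntegral.integral_sub hintq (hf.intervalIntegrable hY.1 _ _),
          hy.2 q (hsub q hq), hY.2 0 q, hY0]
        abel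
      rw [zero_add, h2]
      refine norm_integral_le_mul_abs_integral hf.nonneg (fun r hr => ?_)
        ((hcont'.mono hsubq).intervalIntegrable)
      rw [← hfd r (hsub r (hsubq hr))]
      exact hf.lipschitz r _ _) r hr
  simp only [mul_zero, zero_mul, norm_le_zero_iff, sub_eq_zero] at h1
  exact h1

theorem IsTraj.eqOn_of_isGlobalSolution (hT : 0 ≤ T) (hf : IsCaratheodoryField f LF M)
    (hfd : ∀ r ∈ Icc 0 T, ∀ x, f r x = F x (d r)) {y Y : ℝ → EucSp n} {x : EucSp n}
    (hy : IsTraj F d 0 T x y) (hY : IsGlobalSolution f Y) (hY0 : Y 0 = x) :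
    EqOn y Y (Icc 0 T) := by
  refine hy.eq_of_intervalIntegrable hf hfd hY hY0 (right_mem_Icc.2 hT) ?_
  set S : Set ℝ :=
    {s | s ∈ Icc 0 T ∧ IntervalIntegrable (fun r => F (y r) (d r)) volume 0 s}
  have h0S : (0 : ℝ) ∈ S := ⟨left_mem_Icc.2 hT, IntervalIntegrable.refl⟩
  have hSbdd : BddAbove S := ⟨T, fun s hs => hs.1.2⟩
  set a := sSup S
  have ha0 : 0 ≤ a := le_csSup hSbdd h0S
  have haT : a ≤ T := csSup_le ⟨0, h0S⟩ fun s hs => hs.1.2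
  have hleft : IntervalIntegrable (fun r => F (y r) (d r)) volume 0 a := by
    refine (hf.intervalIntegrable hY.1 0 a).congr_uIoo fun r hr => ?_
    rw [uIoo_of_le ha0] at hr
    obtain ⟨s, hsS, hrs⟩ := exists_lt_of_lt_csSup ⟨0, h0S⟩ hr.2
    change f r (Y r) = F (y r) (d r)
    rw [hfd r ⟨hr.1.le, hr.2.le.trans haT⟩,
      hy.eq_of_intervalIntegrable hf hfd hY hY0 hsS.1 hsS.2 r ⟨hr.1.le, hrs.le⟩]
  have hright : IntervalIntegrable (fun r => F (y r) (d r)) volume a T := by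
    refine (hf.intervalIntegrable (continuous_const (y := x)) a T).congr_uIoo fun r hr => ?_
    rw [uIoo_of_le haT] at hr
    have hrT : r ∈ Icc 0 T := ⟨ha0.trans hr.1.le, hr.2.le⟩
    have hrS : ¬ IntervalIntegrable (fun r => F (y r) (d r)) volume 0 r := fun h =>
      hr.1.not_ge (le_csSup hSbdd ⟨hrT, h⟩)
    change f r x = F (y r) (d r)
    rw [hfd r hrT, hy.2 r hrT, intervalIntegral.integral_undef hrS, add_zero]
  exact hleft.trans hright

theorem IsGlobalSolution.isTraj (hfd : ∀ r ∈ Icc 0 T, ∀ x, f r x = F x (d r))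
    {Y : ℝ → EucSp n} (hY : IsGlobalSolution f Y) : IsTraj F d 0 T (Y 0) Y := by
  refine ⟨rfl, fun s hs => ?_⟩
  rw [hY.2 0 s]
  congr 1
  refine intervalIntegral.integral_congr fun r hr => ?_
  rw [uIcc_of_le hs.1] at hr
  exact hfd r ⟨hr.1, hr.2.trans hs.2⟩ _

theorem IsTraj.exists_isGlobalSolution (hT : 0 ≤ T) (hf : IsCaratheodoryField f LF M)
    (hfd : ∀ r ∈ Icc 0 T, ∀ x, f r x = F x (d r)) {y : ℝ → EucSp n} {x : EucSp n}
    (hy : IsTraj F d 0 T x y) :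
    ∃ Y, IsGlobalSolution f Y ∧ Y 0 = x ∧ EqOn y Y (Icc 0 T) := by
  obtain ⟨Y, hY, hY0⟩ := hf.exists_isGlobalSolution 0 x
  exact ⟨Y, hY, hY0, hy.eqOn_of_isGlobalSolution hT hf hfd hY hY0⟩

end Trajectories

section Payoff

theorem continuous_ciSup_of_finite {X ι : Type*} [TopologicalSpace X] [Finite ι] [Nonempty ι]
    {a : ι → X → ℝ} (ha : ∀ i, Continuous (a i)) : Continuous fun x => ⨆ i, a i x := by
  have := Fintype.ofFinite ι
  simp_rw [← Finset.sup'_univ_eq_ciSup]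
  exact Continuous.finset_sup'_apply _ fun i _ => ha i

theorem ciSup_le_iff_of_finite {ι : Type*} [Finite ι] [Nonempty ι] {a : ι → ℝ} {c : ℝ} :
    ⨆ i, a i ≤ c ↔ ∀ i, a i ≤ c :=
  ciSup_le_iff (finite_range a).bddAbove

/-- If the boundary of `{maxᵢ aᵢ ≤ 0}` is its zero level set, then zeros of `maxᵢ aᵢ` are limits of
points where it is positive. -/
theorem mem_closure_pos_of_frontier_eq {X ι : Type*} [TopologicalSpace X] [Finite ι] [Nonempty ι]
    {a : ι → X → ℝ} (hfr : frontier {x | ∀ i, a i x ≤ 0} =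
      ⋃ i, {x | (∀ i', a i' x ≤ 0) ∧ a i x = 0}) {z : X} (hz : ⨆ i, a i z = 0) :
    z ∈ closure {x | 0 < ⨆ i, a i x} := by
  obtain ⟨i, hi⟩ := exists_eq_ciSup_of_finite (f := fun i => a i z)
  have hmem : z ∈ frontier {x | ∀ i, a i x ≤ 0} := by
    rw [hfr]
    exact mem_iUnion.2 ⟨i, ciSup_le_iff_of_finite.1 hz.le, hi.trans hz⟩
  rw [frontier_eq_closure_inter_closure] at hmem
  convert hmem.2 using 2
  ext x
  simp only [mem_ofPred_eq, mem_compl_iff, ← ciSup_le_iff_of_finite, not_le]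

variable {n nX nTR : ℕ} [NeZero nX] {T : ℝ}
  {g : Fin nX → EucSp n → ℝ → ℝ} {l : Fin nTR → EucSp n → ℝ}

theorem payoff_le_iff (hT : 0 ≤ T) (hg : ∀ i, Continuous fun p : EucSp n × ℝ => g i p.1 p.2)
    {y : ℝ → EucSp n} (hy : ContinuousOn y (Icc 0 T)) {c : ℝ} :
    payoff g l 0 T y ≤ c ↔
      (⨆ j, l j (y T)) ≤ c ∧ ∀ s ∈ Icc 0 T, (⨆ i, g i (y s) s) ≤ c := by
  have hbdd : ∀ i, BddAbove ((fun s => g i (y s) s) '' Icc 0 T) := fun i =>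
    (isCompact_Icc.image_of_continuousOn
      ((hg i).comp_continuousOn (hy.prodMk continuousOn_id))).bddAbove
  have hne : ∀ i, ((fun s => g i (y s) s) '' Icc 0 T).Nonempty := fun i =>
    (nonempty_Icc.2 hT).image _
  rw [payoff, max_le_iff, ciSup_le_iff_of_finite (a := fun i => sSup _)]
  refine and_congr_right fun _ => ?_
  simp only [ciSup_le_iff_of_finite, csSup_le_iff (hbdd _) (hne _), forall_mem_image]
  exact ⟨fun h s hs i => h i hs, fun h i s hs => h s hs i⟩

/-- The payoff of a trajectory is realised at some time `τ` by a continuous function of the state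
bounding every payoff from below. -/
theorem exists_payoff_eq [NeZero nTR] (hT : 0 ≤ T)
    (hg : ∀ i, Continuous fun p : EucSp n × ℝ => g i p.1 p.2)
    (hl : ∀ j, Continuous (l j))
    (hfrX : ∀ t ∈ Icc (0 : ℝ) T, frontier {x : EucSp n | ∀ i, g i x t ≤ 0} =
      ⋃ i, {x : EucSp n | (∀ i', g i' x t ≤ 0) ∧ g i x t = 0})
    (hfrTR : frontier {x : EucSp n | ∀ j, l j x ≤ 0} =
      ⋃ j, {x : EucSp n | (∀ j', l j' x ≤ 0) ∧ l j x = 0})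
    {y : ℝ → EucSp n} (hy : ContinuousOn y (Icc 0 T)) :
    ∃ τ ∈ Icc 0 T, ∃ k : EucSp n → ℝ, Continuous k ∧ payoff g l 0 T y = k (y τ) ∧
      (∀ w : ℝ → EucSp n, ContinuousOn w (Icc 0 T) → k (w τ) ≤ payoff g l 0 T w) ∧
      ∀ z, k z = 0 → z ∈ closure {x | 0 < k x} := by
  have hG : Continuous fun p : EucSp n × ℝ => ⨆ i, g i p.1 p.2 := continuous_ciSup_of_finite hg
  obtain ⟨τ, hτ, hmax⟩ := isCompact_Icc.exists_isMaxOn (nonempty_Icc.2 hT)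
    (hG.comp_continuousOn (hy.prodMk continuousOn_id))
  have hmax' : ∀ s ∈ Icc 0 T, (⨆ i, g i (y s) s) ≤ ⨆ i, g i (y τ) τ := fun s hs => hmax hs
  have hself := (payoff_le_iff (l := l) hT hg hy).1 le_rfl
  rcases le_total (⨆ i, g i (y τ) τ) (⨆ j, l j (y T)) with h | h
  · refine ⟨T, right_mem_Icc.2 hT, fun z => ⨆ j, l j z, continuous_ciSup_of_finite hl, ?_,
      fun w hw => ((payoff_le_iff hT hg hw).1 le_rfl).1,
      fun z hz => mem_closure_pos_of_frontier_eq hfrTR hz⟩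
    exact le_antisymm ((payoff_le_iff hT hg hy).2 ⟨le_rfl, fun s hs => (hmax' s hs).trans h⟩)
      hself.1
  · refine ⟨τ, hτ, fun z => ⨆ i, g i z τ,
      hG.comp (by fun_prop : Continuous fun z : EucSp n => (z, τ)), ?_,
      fun w hw => ((payoff_le_iff hT hg hw).1 le_rfl).2 τ hτ,
      fun z hz => mem_closure_pos_of_frontier_eq (a := fun i x => g i x τ) (hfrX τ hτ) hz⟩
    exact le_antisymm ((payoff_le_iff hT hg hy).2 ⟨h, hmax'⟩) (hself.2 τ hτ)

end Payoff

/-- Non-fattening: the zero level set of `u(·, 0)` is exactly the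
topological boundary of its zero sub-level set. -/
theorem stmt13
    {n m nX nTR : ℕ} (hn : 0 < n) (hm : 0 < m) (hnX : 0 < nX) (hnTR : 0 < nTR)
    (T : ℝ) (hT : 0 < T)
    (D : Set (EucSp m)) (hDne : D.Nonempty) (hDcomp : IsCompact D)
    (F : EucSp n → EucSp m → EucSp n)
    (hFcont : Continuous fun p : EucSp n × EucSp m => F p.1 p.2)
    (LF : ℝ) (hLF : 0 ≤ LF)
    (hFlip : ∀ x y : EucSp n, ∀ d ∈ D, ‖F x d - F y d‖ ≤ LF * ‖x - y‖)
    (g : Fin nX → EucSp n → ℝ → ℝ) (l : Fin nTR → EucSp n → ℝ)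
    (hg : ∀ i, LocallyLipschitz fun p : EucSp n × ℝ => g i p.1 p.2)
    (hl : ∀ j, LocallyLipschitz (l j))
    (u : EucSp n → ℝ → ℝ) (hu : IsValueFun F D g l T u)
    (hfrX : ∀ t ∈ Set.Icc (0:ℝ) T, frontier {x : EucSp n | ∀ i, g i x t ≤ 0} =
      ⋃ i, {x : EucSp n | (∀ i', g i' x t ≤ 0) ∧ g i x t = 0})
    (hfrTR : frontier {x : EucSp n | ∀ j, l j x ≤ 0} =
      ⋃ j, {x : EucSp n | (∀ j', l j' x ≤ 0) ∧ l j x = 0})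
    (hatt : ∀ x : EucSp n, ∃ d y, Admissible D 0 T d ∧ IsTraj F d 0 T x y ∧
      u x 0 = payoff g l 0 T y) :
    {x : EucSp n | u x 0 = 0} = frontier {x : EucSp n | u x 0 ≤ 0} := by
  have : NeZero nX := ⟨hnX.ne'⟩
  have : NeZero nTR := ⟨hnTR.ne'⟩
  have hT0 := hT.le
  have h0T : (0 : ℝ) ∈ Icc 0 T := left_mem_Icc.2 hT0
  have hgc : ∀ i, Continuous fun p : EucSp n × ℝ => g i p.1 p.2 := fun i => (hg i).continuous
  have hlc : ∀ j, Continuous (l j) := fun j => (hl j).continuous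
  have hG : Continuous fun p : EucSp n × ℝ => ⨆ i, g i p.1 p.2 := continuous_ciSup_of_finite hgc
  have hΛ : Continuous fun z : EucSp n => ⨆ j, l j z := continuous_ciSup_of_finite hlc
  set C : ℝ := 2 * Real.exp ((2 * LF + 1) * T)
  have hC0 : 0 < C := by positivity
  have hfield := fun {d : ℝ → EucSp m} (hd : Admissible D 0 T d) =>
    hd.exists_isCaratheodoryField hDne hDcomp hFcont hLF hFlip
  have hcont : ∀ {d x y}, Admissible D 0 T d → IsTraj F d 0 T x y →
      ContinuousOn y (Icc 0 T) := by
    intro d x y hd hy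
    obtain ⟨f, M, hf, hfd⟩ := hfield hd
    obtain ⟨Y, hY, -, hyY⟩ := hy.exists_isGlobalSolution hT0 hf hfd
    exact hY.1.continuousOn.congr hyY
  have hexists : ∀ {d}, Admissible D 0 T d → ∀ τ z, ∃ y, IsTraj F d 0 T (y 0) y ∧ y τ = z := by
    intro d hd τ z
    obtain ⟨f, M, hf, hfd⟩ := hfield hd
    obtain ⟨Y, hY, hYτ⟩ := hf.exists_isGlobalSolution τ z
    exact ⟨Y, hY.isTraj hfd, hYτ⟩
  have hclose : ∀ {d x x' y y'}, Admissible D 0 T d → IsTraj F d 0 T x y →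
      IsTraj F d 0 T x' y' → ∀ τ ∈ Icc 0 T, ∀ s ∈ Icc 0 T,
      ‖y s - y' s‖ ≤ C * ‖y τ - y' τ‖ := by
    intro d x x' y y' hd hy hy' τ hτ s hs
    obtain ⟨f, M, hf, hfd⟩ := hfield hd
    obtain ⟨Y, hY, -, hyY⟩ := hy.exists_isGlobalSolution hT0 hf hfd
    obtain ⟨Y', hY', -, hyY'⟩ := hy'.exists_isGlobalSolution hT0 hf hfd
    rw [hyY hs, hyY hτ, hyY' hs, hyY' hτ]
    exact hf.norm_sub_le hY hY' hτ hs
  have hbounded : ∀ x, ∃ R, ∀ d y, Admissible D 0 T d → IsTraj F d 0 T x y →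
      ∀ s ∈ Icc 0 T, ‖y s - x‖ ≤ R := by
    intro x
    obtain ⟨B, hB⟩ := hDcomp.exists_bound_of_continuousOn (f := fun d => F x d)
      (hFcont.comp (by fun_prop : Continuous fun d : EucSp m => (x, d))).continuousOn
    refine ⟨2 * (B * T) * Real.exp ((2 * LF + 1) * T), fun d y hd hy s hs => ?_⟩
    obtain ⟨f, M, hf, hfd⟩ := hfield hd
    obtain ⟨Y, hY, rfl, hyY⟩ := hy.exists_isGlobalSolution hT0 hf hfd
    rw [hyY hs]
    exact hf.norm_sub_initial_le hY (fun r hr => by rw [hfd r hr]; exact hB _ (hd.2 r hr)) hs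
  have hle : ∀ {d x y}, Admissible D 0 T d → IsTraj F d 0 T x y →
      payoff g l 0 T y ≤ u x 0 := by
    intro d x y hd hy
    rw [hu x 0 h0T]
    refine le_csSup ?_ ⟨d, y, hd, hy, rfl⟩
    obtain ⟨R, hR⟩ := hbounded x
    have hK := isCompact_closedBall x R
    obtain ⟨B, hB⟩ := ((hK.prod (isCompact_Icc (a := (0 : ℝ)) (b := T))).image hG).bddAbove
    obtain ⟨B', hB'⟩ := (hK.image hΛ).bddAbove
    refine ⟨max B' B, ?_⟩
    rintro _ ⟨d', y', hd', hy', rfl⟩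
    have hmem : ∀ s ∈ Icc 0 T, y' s ∈ Metric.closedBall x R := fun s hs => by
      rw [mem_closedBall_iff_norm]
      exact hR d' y' hd' hy' s hs
    refine (payoff_le_iff hT0 hgc (hcont hd' hy')).2 ⟨?_, fun s hs => ?_⟩
    · exact (hB' (mem_image_of_mem _ (hmem T (right_mem_Icc.2 hT0)))).trans (le_max_left _ _)
    · exact (hB (mem_image_of_mem _ (mk_mem_prod (hmem s hs) hs))).trans (le_max_right _ _)
  have hneg : ∀ x, u x 0 < 0 → ∀ᶠ x' in 𝓝 x, u x' 0 ≤ 0 := by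
    intro x hx
    obtain ⟨R, hR⟩ := hbounded x
    have hK := isCompact_closedBall x (R + 1)
    obtain ⟨δ₁, hδ₁, hG'⟩ := Metric.uniformContinuousOn_iff.1
      ((hK.prod (isCompact_Icc (a := (0 : ℝ)) (b := T))).uniformContinuousOn_of_continuous
        hG.continuousOn) (-u x 0) (by linarith)
    obtain ⟨δ₂, hδ₂, hΛ'⟩ := Metric.uniformContinuousOn_iff.1
      (hK.uniformContinuousOn_of_continuous hΛ.continuousOn) (-u x 0) (by linarith)
    set δ := min 1 (min δ₁ δ₂)
    have hδ : 0 < δ := by positivity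
    filter_upwards [Metric.ball_mem_nhds x (div_pos hδ hC0)] with x' hx'
    rw [mem_ball_iff_norm, lt_div_iff₀ hC0, mul_comm] at hx'
    obtain ⟨d, y', hd, hy', hux'⟩ := hatt x'
    obtain ⟨y, hy, hy0⟩ := hexists hd 0 x
    rw [hy0] at hy
    have hd' : ∀ s ∈ Icc 0 T, ‖y' s - y s‖ < δ := fun s hs => by
      have := hclose hd hy' hy 0 h0T s hs
      rw [hy'.1, hy0] at this
      exact this.trans_lt hx'
    have hmem : ∀ s ∈ Icc 0 T, y s ∈ Metric.closedBall x (R + 1) := fun s hs => by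
      rw [mem_closedBall_iff_norm]
      linarith [hR d y hd hy s hs]
    have hmem' : ∀ s ∈ Icc 0 T, y' s ∈ Metric.closedBall x (R + 1) := fun s hs => by
      rw [mem_closedBall_iff_norm]
      have h1 := hR d y hd hy s hs
      have h2 := norm_sub_le_norm_sub_add_norm_sub (y' s) (y s) x
      linarith [hd' s hs, min_le_left 1 (min δ₁ δ₂)]
    have hpay := (payoff_le_iff hT0 hgc (hcont hd hy)).1 (hle hd hy)
    rw [hux']
    refine (payoff_le_iff hT0 hgc (hcont hd hy')).2 ⟨?_, fun s hs => ?_⟩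
    · have hTT := right_mem_Icc.2 hT0
      have h1 := hΛ' _ (hmem' T hTT) _ (hmem T hTT) (by
        rw [dist_eq_norm]
        exact (hd' T hTT).trans_le ((min_le_right _ _).trans (min_le_right _ _)))
      rw [Real.dist_eq, abs_lt] at h1
      linarith [hpay.1]
    · have h1 := hG' (y' s, s) ⟨hmem' s hs, hs⟩ (y s, s) ⟨hmem s hs, hs⟩ (by
        rw [dist_prod_same_right, dist_eq_norm]
        exact (hd' s hs).trans_le ((min_le_right _ _).trans (min_le_left _ _)))
      rw [Real.dist_eq, abs_lt] at h1
      linarith [hpay.2 s hs]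
  have hpos : ∀ x, 0 < u x 0 → ∀ᶠ x' in 𝓝 x, 0 < u x' 0 := by
    intro x hx
    obtain ⟨d, y, hd, hy, hux⟩ := hatt x
    obtain ⟨τ, hτ, k, hk, hky, hkle, -⟩ :=
      exists_payoff_eq hT0 hgc hlc hfrX hfrTR (hcont hd hy)
    rw [hux, hky] at hx
    obtain ⟨δ, hδ, hball⟩ := Metric.eventually_nhds_iff_ball.1
      (hk.continuousAt.eventually (lt_mem_nhds hx))
    filter_upwards [Metric.ball_mem_nhds x (div_pos hδ hC0)] with x' hx'
    rw [mem_ball_iff_norm, lt_div_iff₀ hC0, mul_comm] at hx'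
    obtain ⟨y', hy', hy0⟩ := hexists hd 0 x'
    rw [hy0] at hy'
    refine lt_of_lt_of_le (hball (y' τ) ?_) ((hkle y' (hcont hd hy')).trans (hle hd hy'))
    have := hclose hd hy' hy 0 h0T τ hτ
    rw [hy0, hy.1] at this
    rw [mem_ball_iff_norm]
    exact this.trans_lt hx'
  ext x
  constructor
  · intro hx
    rw [frontier_eq_closure_inter_closure]
    refine ⟨subset_closure (le_of_eq hx), Metric.mem_closure_iff.2 fun ε hε => ?_⟩
    obtain ⟨d, y, hd, hy, hux⟩ := hatt x
    obtain ⟨τ, hτ, k, hk, hky, hkle, hcl⟩ :=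
      exists_payoff_eq hT0 hgc hlc hfrX hfrTR (hcont hd hy)
    obtain ⟨z, hz, hzy⟩ := Metric.mem_closure_iff.1
      (hcl (y τ) (hky.symm.trans (hux.symm.trans hx))) (ε / C) (div_pos hε hC0)
    obtain ⟨y', hy', rfl⟩ := hexists hd τ z
    refine ⟨y' 0, not_le.2 (hz.trans_le ((hkle y' (hcont hd hy')).trans (hle hd hy'))), ?_⟩
    have := hclose hd hy hy' τ hτ 0 h0T
    rw [hy.1, ← dist_eq_norm, ← dist_eq_norm] at this
    rw [lt_div_iff₀ hC0, mul_comm] at hzy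
    exact this.trans_lt hzy
  · intro hx
    rcases lt_trichotomy (u x 0) 0 with h | h | h
    · exact absurd (mem_interior_iff_mem_nhds.2 (hneg x h)) hx.2
    · exact h
    · obtain ⟨x', h1, h2⟩ := mem_closure_iff_frequently.1 hx.1 |>.and_eventually (hpos x h) |>.exists
      exact absurd h2 (not_lt.2 h1)

end
end

section
/- Assume ∂X_t ∩ ∂B = ∅ for every t ∈ [0,T]. If ψ is a C^∞ function on ℝ^n × [0,T] satisfying ∂_t ψ(x,t) + ⟨∇_x ψ(x,t), f(x,d)⟩ ≤ 0 for all (x,t,d) ∈ B × [0,T] × 𝒟 and ψ(x,t) ≥ g_i(x,t) for all (x,t) ∈ B × [0,T] and all i = 1,…,n_X, then for every x₀ ∈ B with ψ(x₀,0) ≤ 0 and every admissible uncertainty d on [0,T], the unique maximal solution y of ẏ(s) = f(y(s), d(s)) with y(0) = x₀ is defined on all of [0,T] and satisfies y(t) ∈ X_t for every t ∈ [0,T]. -/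
open Set MeasureTheory RealInnerProductSpace Filter Topology

noncomputable section

/-- Global existence of Carathéodory solutions on `[0, T]` for a bounded, globally Lipschitz,
time-measurable vector field. The solution is Lipschitz and satisfies the ODE almost everywhere. -/
theorem exists_caratheodory_solution {E : Type*} [NormedAddCommGroup E] [NormedSpace ℝ E]
    [CompleteSpace E] {G : ℝ → E → E} {L M T : ℝ} (hT : 0 ≤ T) (hL : 0 ≤ L)
    (hmeas : ∀ u : ℝ → E, Continuous u → AEStronglyMeasurable (fun t => G t (u t)) volume)
    (hlip : ∀ t x y, ‖G t x - G t y‖ ≤ L * ‖x - y‖) (hbdd : ∀ t x, ‖G t x‖ ≤ M) (x₀ : E) :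
    ∃ y : ℝ → E, LocallyLipschitz y ∧
      (∀ t ∈ Icc 0 T, y t = x₀ + ∫ r in (0 : ℝ)..t, G r (y r)) ∧
      ∀ᵐ t, t ∈ Icc 0 T → HasDerivAt y (G t (y t)) t := by
  have hloc (u : ℝ → E) (hu : Continuous u) : LocallyIntegrable (fun t => G t (u t)) volume :=
    (locallyIntegrable_const M).mono (hmeas u hu)
      (Eventually.of_forall fun t => (hbdd t _).trans (le_abs_self M))
  have hint (u : ℝ → E) (hu : Continuous u) (a b : ℝ) :
      IntervalIntegrable (fun t => G t (u t)) volume a b :=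
    intervalIntegrable_iff.2 <|
      ((hloc u hu).integrableOn_isCompact isCompact_uIcc).mono_set uIoc_subset_uIcc
  have hprim (u : ℝ → E) (hu : Continuous u) :
      LipschitzWith (Real.toNNReal M) (fun t => x₀ + ∫ r in (0 : ℝ)..t, G r (u r)) := by
    refine LipschitzWith.of_dist_le_mul fun s t => ?_
    rw [dist_eq_norm, add_sub_add_left_eq_sub,
      intervalIntegral.integral_interval_sub_left (hint u hu _ _) (hint u hu _ _),
      Real.dist_eq, Real.coe_toNNReal _ ((norm_nonneg _).trans (hbdd 0 0))]
    exact intervalIntegral.norm_integral_le_of_norm_le_const fun r _ => hbdd r _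
  -- Picard iteration is a contraction for the sup norm weighted by `exp (-c t)`.
  set c : ℝ := 2 * L + 1 with hc
  let unweight (z : C(Icc 0 T, E)) : ℝ → E := fun r => Real.exp (c * r) • IccExtend hT z r
  have hunweight (z : C(Icc 0 T, E)) : Continuous (unweight z) :=
    (by fun_prop : Continuous fun r : ℝ => Real.exp (c * r)).smul z.continuous.Icc_extend'
  let Φ (z : C(Icc 0 T, E)) : C(Icc 0 T, E) :=
    ⟨fun t => Real.exp (-(c * t)) • (x₀ + ∫ r in (0 : ℝ)..t, G r (unweight z r)),
      (by fun_prop : Continuous fun t : Icc 0 T => Real.exp (-(c * t))).smul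
        ((hprim _ (hunweight z)).continuous.comp continuous_subtype_val)⟩
  have hexp (t : ℝ) : ∫ r in (0 : ℝ)..t, c * Real.exp (c * r) = Real.exp (c * t) - 1 := by
    rw [intervalIntegral.integral_eq_sub_of_hasDerivAt (f := fun r => Real.exp (c * r))]
    · simp
    · intro r _
      simpa [mul_comm] using ((hasDerivAt_id r).const_mul c).exp
    · exact Continuous.intervalIntegrable (by fun_prop) _ _
  have hΦ : ContractingWith (1 / 2) Φ := by
    refine ⟨by rw [← NNReal.coe_lt_coe]; norm_num, LipschitzWith.of_dist_le_mul fun z w => ?_⟩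
    rw [ContinuousMap.dist_le (by positivity)]
    intro t
    have hdist : ‖∫ r in (0 : ℝ)..t, (G r (unweight z r) - G r (unweight w r))‖ ≤
        ∫ r in (0 : ℝ)..t, dist z w / 2 * (c * Real.exp (c * r)) := by
      refine intervalIntegral.norm_integral_le_of_norm_le t.2.1
        (Eventually.of_forall fun r _ => ?_) (Continuous.intervalIntegrable (by fun_prop) _ _)
      have hzw : ‖IccExtend hT z r - IccExtend hT w r‖ ≤ dist z w := by
        rw [← dist_eq_norm]
        exact ContinuousMap.dist_apply_le_dist _
      refine (hlip r _ _).trans ?_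
      simp only [unweight]
      rw [← smul_sub, norm_smul, Real.norm_of_nonneg (Real.exp_pos _).le]
      calc L * (Real.exp (c * r) * ‖IccExtend hT z r - IccExtend hT w r‖)
          ≤ (c / 2) * (Real.exp (c * r) * dist z w) := by gcongr; linarith
        _ = _ := by ring
    rw [intervalIntegral.integral_const_mul, hexp] at hdist
    simp only [Φ, ContinuousMap.coe_mk]
    rw [dist_eq_norm, ← smul_sub, add_sub_add_left_eq_sub, norm_smul,
      Real.norm_of_nonneg (Real.exp_pos _).le,
      ← intervalIntegral.integral_sub (hint _ (hunweight z) _ _) (hint _ (hunweight w) _ _)]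
    calc _ ≤ Real.exp (-(c * t)) * (dist z w / 2 * (Real.exp (c * t) - 1)) := by gcongr
      _ ≤ Real.exp (-(c * t)) * (dist z w / 2 * Real.exp (c * t)) := by gcongr; linarith
      _ = Real.exp (-(c * t)) * Real.exp (c * t) * (dist z w / 2) := by ring
      _ = ((1 / 2 : NNReal) : ℝ) * dist z w := by
        rw [← Real.exp_add]; simp; ring
  have : Nonempty C(Icc 0 T, E) := ⟨0⟩
  set z := ContractingWith.fixedPoint Φ hΦ
  have hz : Φ z = z := hΦ.fixedPoint_isFixedPt
  set u := unweight z
  set y : ℝ → E := fun t => x₀ + ∫ r in (0 : ℝ)..t, G r (u r) with hy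
  have huy : ∀ t ∈ Icc 0 T, u t = y t := fun t ht => by
    have : u t = Real.exp (c * t) • Φ z ⟨t, ht⟩ := by
      rw [hz]
      simp only [u, unweight]
      rw [IccExtend_of_mem hT _ ht]
    rw [this]
    change Real.exp (c * t) • Real.exp (-(c * t)) • y t = y t
    rw [smul_smul, ← Real.exp_add]
    simp
  refine ⟨y, (hprim u (hunweight z)).locallyLipschitz, fun t ht => ?_, ?_⟩
  · rw [hy]
    simp only [add_right_inj]
    refine intervalIntegral.integral_congr fun r hr => ?_
    rw [uIcc_of_le ht.1] at hr
    simp only [huy r ⟨hr.1, hr.2.trans ht.2⟩, hy]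
  · filter_upwards [LocallyIntegrable.ae_hasDerivAt_integral (hloc u (hunweight z))] with t ht htT
    rw [← huy t htT]
    exact (ht 0).const_add x₀

/-- A locally Lipschitz function with nonpositive derivative almost everywhere on `[a, b]` does not
increase from `a` to `b`. -/
theorem LocallyLipschitz.le_of_ae_deriv_nonpos {h : ℝ → ℝ} {a b : ℝ} (hab : a ≤ b)
    (hh : LocallyLipschitz h) (hderiv : ∀ᵐ t, t ∈ Icc a b → deriv h t ≤ 0) : h b ≤ h a := by
  obtain ⟨K, hK⟩ := (hh.locallyLipschitzOn (s := uIcc a b)).exists_lipschitzOnWith_of_compact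
    isCompact_uIcc
  have hac := hK.absolutelyContinuousOnInterval
  have hle : ∫ t in a..b, deriv h t ≤ ∫ _ in a..b, (0 : ℝ) :=
    intervalIntegral.integral_mono_ae_restrict hab hac.intervalIntegrable_deriv (by simp)
      ((ae_restrict_iff' measurableSet_Icc).2 hderiv)
  rw [hac.integral_deriv_eq_sub] at hle
  simp only [intervalIntegral.integral_zero] at hle
  linarith

/-- The chain rule for a function of space and time along a curve, in terms of the partial time
derivative and the spatial gradient. -/
theorem hasDerivAt_along_curve {E : Type*} [NormedAddCommGroup E] [InnerProductSpace ℝ E]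
    [CompleteSpace E] {ψ : E → ℝ → ℝ} {y : ℝ → E} {v : E} {t : ℝ}
    (hψ : DifferentiableAt ℝ (fun p : E × ℝ => ψ p.1 p.2) (y t, t)) (hy : HasDerivAt y v t) :
    HasDerivAt (fun s => ψ (y s) s)
      (deriv (ψ (y t)) t + ⟪gradient (fun z => ψ z t) (y t), v⟫) t := by
  set A := fderiv ℝ (fun p : E × ℝ => ψ p.1 p.2) (y t, t)
  have hA : HasFDerivAt (fun p : E × ℝ => ψ p.1 p.2) A (y t, t) := hψ.hasFDerivAt
  have htime : deriv (ψ (y t)) t = A (0, 1) :=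
    (hA.comp_hasDerivAt t ((hasDerivAt_const t (y t)).prodMk (hasDerivAt_id t))).deriv
  have hspace : HasFDerivAt (fun z => ψ z t) (A.comp (ContinuousLinearMap.inl ℝ E ℝ)) (y t) :=
    HasFDerivAt.comp (f := fun z => (z, t)) (y t) hA (hasFDerivAt_prodMk_left (y t) t)
  have hgrad : ⟪gradient (fun z => ψ z t) (y t), v⟫ = A (v, 0) := by
    rw [gradient, InnerProductSpace.toDual_symm_apply, hspace.fderiv]
    simp
  have hcurve := HasFDerivAt.comp_hasDerivAt (f := fun s => (y s, s)) t hA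
    (hy.prodMk (hasDerivAt_id t))
  rw [htime, hgrad, ← map_add]
  simpa [Function.comp_def] using hcurve

/-- Coordinatewise clamping to the box `[-ρ, ρ]ⁿ`. -/
def clampBox {n : ℕ} (ρ : ℝ) (x : EucSp n) : EucSp n :=
  WithLp.toLp 2 fun i => max (-ρ) (min ρ (x i))

theorem norm_clampBox_sub_le {n : ℕ} (ρ : ℝ) (x y : EucSp n) :
    ‖clampBox ρ x - clampBox ρ y‖ ≤ ‖x - y‖ := by
  rw [EuclideanSpace.norm_eq, EuclideanSpace.norm_eq]
  gcongr with i
  simp only [clampBox, PiLp.sub_apply, Real.norm_eq_abs]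
  have h₁ := abs_max_sub_max_le_max (-ρ) (min ρ (x i)) (-ρ) (min ρ (y i))
  have h₂ := abs_min_sub_min_le_max ρ (x i) ρ (y i)
  simp only [sub_self, abs_zero, max_eq_right, abs_nonneg] at h₁ h₂
  exact h₁.trans h₂

theorem continuous_clampBox {n : ℕ} (ρ : ℝ) : Continuous (clampBox (n := n) ρ) :=
  (LipschitzWith.of_dist_le_mul (K := 1) fun x y => by
    simpa [dist_eq_norm] using norm_clampBox_sub_le ρ x y).continuous

theorem exists_isCompact_clampBox_mem {n : ℕ} {ρ : ℝ} (hρ : 0 ≤ ρ) :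
    ∃ K : Set (EucSp n), IsCompact K ∧ ∀ x, clampBox ρ x ∈ K := by
  refine ⟨WithLp.toLp 2 '' Set.pi univ fun _ : Fin n => Icc (-ρ) ρ,
    (isCompact_univ_pi fun _ => isCompact_Icc).image (PiLp.continuous_toLp 2 _),
    fun x => ⟨_, fun i _ => ?_, rfl⟩⟩
  exact ⟨le_max_left _ _, max_le (by linarith) (min_le_left _ _)⟩

theorem clampBox_eq_self {n : ℕ} {R : ℝ} {x : EucSp n} (hx : ∑ i, x i ^ 2 ≤ R) :
    clampBox (√R) x = x := by
  ext i
  have hi : |x i| ≤ √R := Real.abs_le_sqrt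
    ((Finset.single_le_sum (f := fun i => x i ^ 2) (fun j _ => sq_nonneg _)
      (Finset.mem_univ i)).trans hx)
  rw [abs_le] at hi
  simp [clampBox, hi.1, hi.2]

/-- A vector field which is continuous and Lipschitz in the state over compact sets admits, for
each admissible uncertainty, a locally Lipschitz curve on `[0, T]` driven by the field composed
with clamping to a box. -/
theorem exists_clamped_traj {n m : ℕ} {T ρ : ℝ} (hT : 0 ≤ T) (hρ : 0 ≤ ρ)
    {D : Set (EucSp m)} (hDne : D.Nonempty) (hDcomp : IsCompact D)
    {f : EucSp n → EucSp m → EucSp n}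
    (hfcont : Continuous fun p : EucSp n × EucSp m => f p.1 p.2)
    (hflip : ∀ K : Set (EucSp n), IsCompact K → ∃ L, 0 ≤ L ∧
      ∀ x ∈ K, ∀ y ∈ K, ∀ d ∈ D, ‖f x d - f y d‖ ≤ L * ‖x - y‖)
    (x₀ : EucSp n) {d : ℝ → EucSp m} (hd : Admissible D 0 T d) :
    ∃ y : ℝ → EucSp n, LocallyLipschitz y ∧
      (∀ t ∈ Icc 0 T, y t = x₀ + ∫ r in (0 : ℝ)..t, f (clampBox ρ (y r)) (d r)) ∧
      ∀ᵐ t, t ∈ Icc 0 T → HasDerivAt y (f (clampBox ρ (y t)) (d t)) t := by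
  classical
  obtain ⟨d₀, hd₀⟩ := hDne
  set e : ℝ → EucSp m := (Icc 0 T).piecewise d fun _ => d₀ with he
  have heD (t : ℝ) : e t ∈ D := by
    by_cases ht : t ∈ Icc 0 T
    · simpa [he, Set.piecewise_eq_of_mem _ _ _ ht] using hd.2 t ht
    · simpa [he, Set.piecewise_eq_of_notMem _ _ _ ht] using hd₀
  have hed : ∀ t ∈ Icc 0 T, e t = d t := fun t ht => Set.piecewise_eq_of_mem _ _ _ ht
  have hemeas : Measurable e := hd.1.piecewise measurableSet_Icc measurable_const
  obtain ⟨K, hK, hmem⟩ := exists_isCompact_clampBox_mem (n := n) hρ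
  obtain ⟨L, hL, hlip⟩ := hflip K hK
  obtain ⟨M, hM⟩ := (hK.prod hDcomp).exists_bound_of_continuousOn hfcont.continuousOn
  obtain ⟨y, hy, hint, hderiv⟩ := exists_caratheodory_solution
    (G := fun t x => f (clampBox ρ x) (e t)) hT hL
    (fun u hu => (hfcont.measurable.comp
      (((continuous_clampBox ρ).comp hu).measurable.prodMk hemeas)).aestronglyMeasurable)
    (fun t x y => (hlip _ (hmem x) _ (hmem y) _ (heD t)).trans
      (mul_le_mul_of_nonneg_left (norm_clampBox_sub_le ρ x y) hL))
    (fun t x => hM (clampBox ρ x, e t) ⟨hmem x, heD t⟩) x₀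
  refine ⟨y, hy, fun t ht => ?_, ?_⟩
  · rw [hint t ht]
    congr 1
    refine intervalIntegral.integral_congr fun r hr => ?_
    rw [uIcc_of_le ht.1] at hr
    simp only [hed r ⟨hr.1, hr.2.trans ht.2⟩]
  · filter_upwards [hderiv] with t ht htT
    rw [← hed t htT]
    exact ht htT

/-- A subset of `B` whose frontier avoids the frontier of `B` lies in the interior of `B`. -/
theorem subset_interior_of_frontier_inter_eq_empty {X : Type*} [TopologicalSpace X]
    {A B : Set X} (hAB : A ⊆ B) (hfr : frontier A ∩ frontier B = ∅) :
    A ⊆ interior B := by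
  intro x hx
  by_contra hxB
  have hxA : x ∈ frontier A := ⟨subset_closure hx, fun h => hxB (interior_mono hAB h)⟩
  exact (hfr ▸ (⟨hxA, subset_closure (hAB hx), hxB⟩ : x ∈ frontier A ∩ frontier B) :
    x ∈ (∅ : Set X))

/-- Trajectories starting in the zero sub-level set of `ψ(·, 0)` exist
on all of `[0, T]` and respect the state constraints. -/
theorem stmt16
    {n m nX : ℕ} (hn : 0 < n) (hm : 0 < m) (hnX : 0 < nX)
    (T : ℝ) (hT : 0 < T)
    (D : Set (EucSp m)) (hDne : D.Nonempty) (hDcomp : IsCompact D)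
    (g : Fin nX → EucSp n → ℝ → ℝ)
    (hg : ∀ i, LocallyLipschitz fun p : EucSp n × ℝ => g i p.1 p.2)
    (f : EucSp n → EucSp m → EucSp n)
    (hfcont : Continuous fun p : EucSp n × EucSp m => f p.1 p.2)
    (hflip : ∀ K : Set (EucSp n), IsCompact K → ∃ L, 0 ≤ L ∧
      ∀ x ∈ K, ∀ y ∈ K, ∀ d ∈ D, ‖f x d - f y d‖ ≤ L * ‖x - y‖)
    (R : ℝ) (hR : 0 < R)
    (Bset : Set (EucSp n)) (hB : Bset = {x : EucSp n | ∑ i, x i ^ 2 ≤ R})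
    (hXB : ∀ t ∈ Set.Icc (0:ℝ) T, {x : EucSp n | ∀ i, g i x t ≤ 0} ⊆ Bset)
    (hfr : ∀ t ∈ Set.Icc (0:ℝ) T,
      frontier {x : EucSp n | ∀ i, g i x t ≤ 0} ∩ frontier Bset = ∅)
    (ψ : EucSp n → ℝ → ℝ)
    (hψ : ContDiff ℝ (⊤ : ℕ∞) (fun p : EucSp n × ℝ => ψ p.1 p.2))
    (hdecr : ∀ x ∈ Bset, ∀ t ∈ Set.Icc (0:ℝ) T, ∀ d ∈ D,
      deriv (ψ x) t + ⟪gradient (fun z => ψ z t) x, f x d⟫ ≤ 0)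
    (hgψ : ∀ x ∈ Bset, ∀ t ∈ Set.Icc (0:ℝ) T, ∀ i, g i x t ≤ ψ x t) :
    ∀ x₀ ∈ Bset, ψ x₀ 0 ≤ 0 → ∀ d : ℝ → EucSp m, Admissible D 0 T d →
      ∃ y : ℝ → EucSp n, IsTraj f d 0 T x₀ y ∧
        ∀ t ∈ Set.Icc (0:ℝ) T, ∀ i, g i (y t) t ≤ 0 := by
  intro x₀ hx₀ hψ₀ d hd
  obtain ⟨y, hyLip, hyint, hyderiv⟩ :=
    exists_clamped_traj hT.le (Real.sqrt_nonneg R) hDne hDcomp hfcont hflip x₀ hd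
  have hclamp : ∀ x ∈ Bset, clampBox (√R) x = x := fun x hx =>
    clampBox_eq_self (by rw [hB] at hx; exact hx)
  have hy0 : y 0 = x₀ := by simpa using hyint 0 ⟨le_rfl, hT.le⟩
  have hBclosed : IsClosed Bset := by
    rw [hB]
    exact isClosed_le (by fun_prop) continuous_const
  have hXint (t : ℝ) (ht : t ∈ Icc 0 T) :
      {x : EucSp n | ∀ i, g i x t ≤ 0} ⊆ interior Bset :=
    subset_interior_of_frontier_inter_eq_empty (hXB t ht) (hfr t ht)
  have hψ1 : ContDiff ℝ 1 (fun p : EucSp n × ℝ => ψ p.1 p.2) := hψ.of_le (by simp)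
  have hψy : LocallyLipschitz fun t => ψ (y t) t :=
    hψ1.locallyLipschitz.comp (hyLip.prodMk LocallyLipschitz.id)
  -- As long as the curve has stayed in `Bset`, it satisfies the state constraints.
  have hsafe (t : ℝ) (ht : t ∈ Icc 0 T) (hstay : ∀ r ∈ Icc 0 t, y r ∈ Bset) (i : Fin nX) :
      g i (y t) t ≤ 0 := by
    refine (hgψ _ (hstay t ⟨ht.1, le_rfl⟩) t ht i).trans ?_
    refine (hψy.le_of_ae_deriv_nonpos ht.1 ?_).trans (by simpa [hy0] using hψ₀)
    filter_upwards [hyderiv] with r hr hrt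
    have hrT : r ∈ Icc 0 T := ⟨hrt.1, hrt.2.trans ht.2⟩
    have hrB := hstay r hrt
    have hdr := hr hrT
    rw [hclamp _ hrB] at hdr
    rw [(hasDerivAt_along_curve (hψ1.differentiable one_ne_zero _) hdr).deriv]
    exact hdecr _ hrB r hrT _ (hd.2 r hrT)
  have hinv : Icc 0 T ⊆ y ⁻¹' Bset := by
    refine ((hBclosed.preimage hyLip.continuous).inter
      isClosed_Icc).Icc_subset_of_forall_mem_nhdsGT_of_Icc_subset (by simpa [hy0] using hx₀) ?_
    intro t ht hstay
    have htT : t ∈ Icc 0 T := ⟨ht.1, ht.2.le⟩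
    have hmem : y t ∈ interior Bset := hXint t htT (hsafe t htT hstay)
    exact mem_nhdsWithin_of_mem_nhds
      (hyLip.continuous.continuousAt (mem_interior_iff_mem_nhds.1 hmem))
  refine ⟨y, ⟨hy0, fun t ht => ?_⟩, fun t ht =>
    hsafe t ht fun r hr => hinv ⟨hr.1, hr.2.trans ht.2⟩⟩
  rw [hyint t ht]
  congr 1
  refine intervalIntegral.integral_congr fun r hr => ?_
  rw [uIcc_of_le ht.1] at hr
  simp only [hclamp _ (hinv ⟨hr.1, hr.2.trans ht.2⟩)]

end
end
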